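/- Let σ ∈ S_n² have exactly k arcs and let (i,j) ∈ E_max(σ). Then c(σ⁻_{(i,j)}) + f(σ⁻_{(i,j)}) = c(σ) + f(σ) − (n − 2k). -/

import Mathlib

namespace LinkPat

variable {n : ℕ}

/-- `σ` is an involution (σ² = id). -/
def IsInvol (σ : Equiv.Perm (Fin n)) : Prop := ∀ p, σ (σ p) = p

/-- `(i,j)` is an arc of `σ`: `i < j` and `σ i = j`. -/
def IsArc (σ : Equiv.Perm (Fin n)) (i j : Fin n) : Prop := i < j ∧ σ i = j

/-- The finite set of arcs of `σ`. -/
def arcs (σ : Equiv.Perm (Fin n)) : Finset (Fin n × Fin n) :=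
  Finset.univ.filter fun a => a.1 < a.2 ∧ σ a.1 = a.2

/-- The number of arcs of `σ`. -/
def numArcs (σ : Equiv.Perm (Fin n)) : ℕ := (arcs σ).card

/-- `c(σ)`: the number of crossings, i.e. pairs of arcs `(i,j)`, `(i',j')` with
`i < i' < j < j'`. -/
def crossNum (σ : Equiv.Perm (Fin n)) : ℕ :=
  ((arcs σ ×ˢ arcs σ).filter fun x => x.1.1 < x.2.1 ∧ x.2.1 < x.1.2 ∧ x.1.2 < x.2.2).card

/-- `f(σ)`: the sum over fixed points `p` of the number of arcs over `p`. -/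
def fixNum (σ : Equiv.Perm (Fin n)) : ℕ :=
  (((Finset.univ.filter fun p => σ p = p) ×ˢ arcs σ).filter
    fun x => x.2.1 < x.1 ∧ x.1 < x.2.2).card

/-- The rank matrix `R_σ`: entry `(i,j)` is the number of arcs inside `[i,j]`. -/
def Rmat (σ : Equiv.Perm (Fin n)) (i j : Fin n) : ℕ :=
  ((arcs σ).filter fun a => i ≤ a.1 ∧ a.2 ≤ j).card

/-- The partial order `σ' ⪯ σ` given by pointwise comparison of rank matrices. -/
def rle (σ' σ : Equiv.Perm (Fin n)) : Prop := ∀ i j, Rmat σ' i j ≤ Rmat σ i j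

/-- The strict order `σ' ≺ σ`. -/
def rlt (σ' σ : Equiv.Perm (Fin n)) : Prop := rle σ' σ ∧ σ' ≠ σ

end LinkPat

namespace LinkPat

/-- `σ⁻_{(i,j)}`: the involution obtained from `σ` by deleting the arc `(i,j)`
(making `i` and `j` fixed points). -/
def delArc {n : ℕ} (σ : Equiv.Perm (Fin n)) (i j : Fin n) : Equiv.Perm (Fin n) :=
  σ * Equiv.swap i j

end LinkPat

namespace LinkPat

variable {n : ℕ}

/-- The finite set of fixed points of `σ`. -/
def fixedPts (σ : Equiv.Perm (Fin n)) : Finset (Fin n) :=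
  Finset.univ.filter fun p => σ p = p

lemma mem_arcs {σ : Equiv.Perm (Fin n)} {a : Fin n × Fin n} :
    a ∈ arcs σ ↔ a.1 < a.2 ∧ σ a.1 = a.2 := by
  simp [arcs]

lemma mem_fixedPts {σ : Equiv.Perm (Fin n)} {p : Fin n} : p ∈ fixedPts σ ↔ σ p = p := by
  simp [fixedPts]

lemma crossNum_eq_sum (σ : Equiv.Perm (Fin n)) :
    crossNum σ = ∑ a ∈ arcs σ, ∑ b ∈ arcs σ,
      if a.1 < b.1 ∧ b.1 < a.2 ∧ a.2 < b.2 then 1 else 0 := by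
  rw [crossNum, Finset.card_filter, Finset.sum_product]

lemma fixNum_eq_sum (σ : Equiv.Perm (Fin n)) :
    fixNum σ = ∑ p ∈ fixedPts σ, ∑ a ∈ arcs σ, if a.1 < p ∧ p < a.2 then 1 else 0 := by
  rw [fixNum, Finset.card_filter, Finset.sum_product, fixedPts]

lemma card_fixedPts_add_two_mul_numArcs {σ : Equiv.Perm (Fin n)} (hσ : IsInvol σ) :
    (fixedPts σ).card + 2 * numArcs σ = n := by
  have hup : numArcs σ = (Finset.univ.filter fun p => p < σ p).card := by
    refine Finset.card_bij' (fun a _ => a.1) (fun p _ => (p, σ p)) ?_ ?_ ?_ ?_ <;>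
      simp +contextual [mem_arcs]
  have hdown : numArcs σ = (Finset.univ.filter fun p => σ p < p).card := by
    rw [hup]
    refine Finset.card_bij' (fun p _ => σ p) (fun p _ => σ p) ?_ ?_ ?_ ?_ <;>
      simp [hσ _]
  have hsum : ∑ p : Fin n, ((if σ p = p then 1 else 0) + (if p < σ p then 1 else 0) +
      (if σ p < p then 1 else 0)) = ∑ _p : Fin n, 1 := by
    refine Finset.sum_congr rfl fun p _ => ?_
    rcases lt_trichotomy p (σ p) with h | h | h
    · simp [h, h.ne', h.not_gt]
    · simp [← h]
    · simp [h, h.ne, h.not_gt]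
  simp only [Finset.sum_add_distrib, ← Finset.card_filter] at hsum
  rw [← hup, ← hdown] at hsum
  simp only [Finset.sum_const, Finset.card_univ, Fintype.card_fin, smul_eq_mul, mul_one] at hsum
  rw [fixedPts]
  omega

lemma delArc_apply {σ : Equiv.Perm (Fin n)} (hσ : IsInvol σ) {i j : Fin n} (h : IsArc σ i j)
    (p : Fin n) : delArc σ i j p = if p = i ∨ p = j then p else σ p := by
  have hj : σ j = i := by rw [← h.2, hσ]
  rw [delArc, Equiv.Perm.mul_apply, Equiv.swap_apply_def]
  have := h.2
  grind

lemma arcs_eq_insert_arcs_delArc {σ : Equiv.Perm (Fin n)} (hσ : IsInvol σ) {i j : Fin n}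
    (h : IsArc σ i j) : arcs σ = insert (i, j) (arcs (delArc σ i j)) := by
  have hj : σ j = i := by rw [← h.2, hσ]
  obtain ⟨hlt, hi⟩ := h
  ext ⟨a, b⟩
  simp only [mem_arcs, Finset.mem_insert, Prod.mk.injEq, delArc_apply hσ ⟨hlt, hi⟩]
  grind

lemma notMem_arcs_delArc {σ : Equiv.Perm (Fin n)} (hσ : IsInvol σ) {i j : Fin n}
    (h : IsArc σ i j) : (i, j) ∉ arcs (delArc σ i j) := by
  simp [mem_arcs, delArc_apply hσ h, h.1.ne]

lemma fixedPts_delArc {σ : Equiv.Perm (Fin n)} (hσ : IsInvol σ) {i j : Fin n}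
    (h : IsArc σ i j) : fixedPts (delArc σ i j) = insert i (insert j (fixedPts σ)) := by
  ext p
  simp only [mem_fixedPts, Finset.mem_insert, delArc_apply hσ h]
  grind

/-- For an external arc `(i,j)`, another arc passes over `i` or over `j` exactly as often as it
crosses `(i,j)`. -/
lemma over_endpoints_eq_crossings {σ : Equiv.Perm (Fin n)} (hσ : IsInvol σ) {i j : Fin n}
    (h : IsArc σ i j) (hext : ∀ a b : Fin n, IsArc σ a b → ¬(a < i ∧ j < b))
    {a : Fin n × Fin n} (ha : a ∈ arcs (delArc σ i j)) :
    ((if a.1 < i ∧ i < a.2 then 1 else 0) + if a.1 < j ∧ j < a.2 then 1 else 0 : ℕ) =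
      (if i < a.1 ∧ a.1 < j ∧ j < a.2 then 1 else 0) +
        if a.1 < i ∧ i < a.2 ∧ a.2 < j then 1 else 0 := by
  have hmem : a ∈ arcs σ := by
    rw [arcs_eq_insert_arcs_delArc hσ h]; exact Finset.mem_insert_of_mem ha
  have hne : a ≠ (i, j) := fun e => notMem_arcs_delArc hσ h (e ▸ ha)
  obtain ⟨x, y⟩ := a
  rw [mem_arcs] at hmem
  have hx := hext x y hmem
  have h1 : x ≠ i := by
    rintro rfl; exact hne (Prod.ext rfl (hmem.2.symm.trans h.2))
  have h2 : y ≠ j := by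
    rintro rfl; exact h1 (σ.injective (hmem.2.trans h.2.symm))
  have := h.1
  have := hmem.1
  dsimp only at *
  split_ifs <;> first | rfl | (exfalso; omega)

end LinkPat

/-- deleting an arc `(i,j) ∈ E_max(σ)` of an involution with `k` arcs
decreases `c + f` by exactly `n − 2k`. -/
theorem delete_emax_cf (n k : ℕ) (σ : Equiv.Perm (Fin n))
    (hσ : LinkPat.IsInvol σ) (hk : LinkPat.numArcs σ = k)
    (i j : Fin n) (harc : LinkPat.IsArc σ i j)
    (hext : ∀ a b : Fin n, LinkPat.IsArc σ a b → ¬(a < i ∧ j < b))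
    (hfixin : ∀ p : Fin n, σ p = p → i < p ∧ p < j) :
    LinkPat.crossNum (LinkPat.delArc σ i j) + LinkPat.fixNum (LinkPat.delArc σ i j)
      + (n - 2 * k)
    = LinkPat.crossNum σ + LinkPat.fixNum σ := by
  have hcard := LinkPat.card_fixedPts_add_two_mul_numArcs hσ
  have hnot := LinkPat.notMem_arcs_delArc hσ harc
  have hiF : i ∉ insert j (LinkPat.fixedPts σ) := by
    simp only [Finset.mem_insert, LinkPat.mem_fixedPts, not_or]
    exact ⟨harc.1.ne, fun e => (hfixin i e).1.false⟩
  have hjF : j ∉ LinkPat.fixedPts σ := fun e => (hfixin j (LinkPat.mem_fixedPts.1 e)).2.false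
  have hF : ∑ p ∈ LinkPat.fixedPts σ, (if i < p ∧ p < j then 1 else 0) =
      (LinkPat.fixedPts σ).card := by
    rw [Finset.card_eq_sum_ones]
    exact Finset.sum_congr rfl fun p hp => if_pos (hfixin p (LinkPat.mem_fixedPts.1 hp))
  have hover := Finset.sum_congr (rfl : LinkPat.arcs (LinkPat.delArc σ i j) = _)
    fun a ha => LinkPat.over_endpoints_eq_crossings hσ harc hext ha
  simp only [Finset.sum_add_distrib] at hover
  rw [LinkPat.crossNum_eq_sum, LinkPat.crossNum_eq_sum, LinkPat.fixNum_eq_sum,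
    LinkPat.fixNum_eq_sum, LinkPat.fixedPts_delArc hσ harc,
    LinkPat.arcs_eq_insert_arcs_delArc hσ harc]
  simp only [Finset.sum_insert hnot, Finset.sum_insert hiF, Finset.sum_insert hjF,
    Finset.sum_add_distrib, lt_self_iff_false, false_and, if_false, hF]
  omega
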